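/- For every α ∈ (0,1) and every positive integer m, the closed interval I = [ (r_{α,m}/2 − 1) + (r_{α,m}/2 + 1)·((1+α)/2)^m , (r_{α,m}/2 + 1) + (r_{α,m}/2 − 1)·((1+α)/2)^m ] is contained in Γ_{α,m}; that is, every x ∈ I can be written as a sum of r_{α,m} m-th powers of elements of the central Cantor set C_α. -/

import Mathlib

open scoped BigOperators

/-- The central Cantor set `C_α ⊆ [0,1]`: the set of all sums
`Σ_{n} ε_n · ((1+α)/2) · ((1−α)/2)^n` with `ε_n ∈ {0,1}`. -/
noncomputable def centralCantor (α : ℝ) : Set ℝ :=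
  {x | ∃ ε : ℕ → ℝ, (∀ n, ε n = 0 ∨ ε n = 1) ∧
    x = ∑' n : ℕ, ε n * ((1 + α) / 2) * ((1 - α) / 2) ^ n}

/-- `s_{α,m} = ⌈(2/(1+α))^{m−1}⌉`. -/
noncomputable def sCount (α : ℝ) (m : ℕ) : ℕ := ⌈(2 / (1 + α)) ^ (m - 1)⌉₊

/-- `k_{α,m}`. -/
noncomputable def kCount (α : ℝ) (m : ℕ) : ℕ :=
  if 1 / 3 < α then
    ⌈((3 * α - 1) / 2) / (((1 + α) / 2) ^ (m - 1) * ((1 - α ^ 2) / 4))⌉₊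
  else 0

/-- `r_{α,m} = 2 s_{α,m} + 2 k_{α,m}`. -/
noncomputable def rCount (α : ℝ) (m : ℕ) : ℕ := 2 * sCount α m + 2 * kCount α m

/-- `Γ_{α,m}`: sums of `r_{α,m}` many `m`-th powers of elements of `C_α`. -/
noncomputable def Gam (α : ℝ) (m : ℕ) : Set ℝ :=
  {x | ∃ c : Fin (rCount α m) → ℝ, (∀ i, c i ∈ centralCantor α) ∧ x = ∑ i, c i ^ m}

theorem mul_sub_le_pow_sub_pow {d a b : ℝ} (hd : 0 ≤ d) (hda : d ≤ a) (hab : a ≤ b) (n : ℕ) :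
    (n + 1) * d ^ n * (b - a) ≤ b ^ (n + 1) - a ^ (n + 1) := by
  induction n with
  | zero => simp
  | succ n ih =>
    have hba : 0 ≤ b - a := sub_nonneg.2 hab
    have h₁ : d * ((n + 1) * d ^ n * (b - a)) ≤ b * (b ^ (n + 1) - a ^ (n + 1)) :=
      mul_le_mul (hda.trans hab) ih (by positivity) (hd.trans (hda.trans hab))
    have h₂ : d ^ (n + 1) * (b - a) ≤ a ^ (n + 1) * (b - a) := by gcongr
    push_cast
    linear_combination h₁ + h₂

theorem pow_sub_pow_le_mul_sub {a b : ℝ} (ha : 0 ≤ a) (hab : a ≤ b) (hb : b ≤ 1) (n : ℕ) :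
    b ^ (n + 1) - a ^ (n + 1) ≤ (n + 1) * (b - a) := by
  induction n with
  | zero => simp
  | succ n ih =>
    have hba : 0 ≤ b - a := sub_nonneg.2 hab
    have h₀ : 0 ≤ b ^ (n + 1) - a ^ (n + 1) := sub_nonneg.2 (by gcongr)
    have h₁ : b * (b ^ (n + 1) - a ^ (n + 1)) ≤ 1 * (b ^ (n + 1) - a ^ (n + 1)) := by gcongr
    have h₂ : a ^ (n + 1) * (b - a) ≤ 1 * (b - a) := by
      gcongr
      exact pow_le_one₀ ha (hab.trans hb)
    push_cast
    linear_combination h₁ + h₂ + ih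

/-- If replacing any single low interval `[a i, b i]` by the high interval `[a' i, b' i]` never jumps
over the total length of the other intervals, then the sums of the intervals chosen in all
possible ways cover everything between the extreme ones. -/
theorem exists_choice_sum_mem_Icc {ι : Type*} [Fintype ι] [DecidableEq ι] {a b a' b' : ι → ℝ}
    {x : ℝ} (hlo : ∑ i, a i ≤ x) (hhi : x ≤ ∑ i, b' i)
    (hjump : ∀ (T : Finset ι), ∀ j ∉ T,
      a' j - b j ≤ ∑ i ∈ Finset.univ.erase j,
        ((if i ∈ T then b' i else b i) - (if i ∈ T then a' i else a i))) :
    ∃ T : Finset ι, ∑ i, (if i ∈ T then a' i else a i) ≤ x ∧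
      x ≤ ∑ i, (if i ∈ T then b' i else b i) := by
  let P : Finset ι → Prop := fun T => ∑ i, (if i ∈ T then a' i else a i) ≤ x
  have hP : {T | P T}.Nonempty := ⟨∅, by simpa [P] using hlo⟩
  obtain ⟨T, hT⟩ := (Set.toFinite {T | P T}).exists_maximal hP
  refine ⟨T, hT.prop, ?_⟩
  by_cases hall : ∀ j, j ∈ T
  · simpa [hall] using hhi
  obtain ⟨j, hj⟩ := not_forall.1 hall
  have hnot : ¬ P (insert j T) := fun h =>
    hj (hT.le_of_ge h (Finset.subset_insert j T) (Finset.mem_insert_self j T))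
  have hx : x < ∑ i, (if i ∈ insert j T then a' i else a i) := not_le.1 hnot
  rw [← Finset.add_sum_erase _ _ (Finset.mem_univ j)] at hx ⊢
  have hsum : ∑ i ∈ Finset.univ.erase j, (if i ∈ insert j T then a' i else a i) =
      ∑ i ∈ Finset.univ.erase j, (if i ∈ T then a' i else a i) := by
    refine Finset.sum_congr rfl fun i hi => ?_
    simp [Finset.ne_of_mem_erase hi]
  have hgap := hjump T j hj
  rw [Finset.sum_sub_distrib] at hgap
  rw [hsum, if_pos (Finset.mem_insert_self j T)] at hx
  rw [if_neg hj]
  linarith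

/-- Subdividing every interval `[p i, p i + l]` into its first and last pieces of length `lam * l`
loses no value of the sum of powers. -/
theorem exists_subdivision {lam mu l x : ℝ} {n r : ℕ} (hlam : 0 ≤ lam) (hle : lam ≤ mu)
    (hsum : lam + mu = 1) (hr : mu - lam ≤ (r - 1) * (mu ^ n * lam)) (hl : 0 ≤ l)
    {p : Fin r → ℝ} (hp : ∀ i, mu ≤ p i) (hp' : ∀ i, p i + l ≤ 1)
    (hlo : ∑ i, p i ^ (n + 1) ≤ x) (hhi : x ≤ ∑ i, (p i + l) ^ (n + 1)) :
    ∃ e : Fin r → ℝ, (∀ i, e i = 0 ∨ e i = 1) ∧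
      ∑ i, (p i + e i * mu * l) ^ (n + 1) ≤ x ∧
      x ≤ ∑ i, (p i + e i * mu * l + lam * l) ^ (n + 1) := by
  have hmu : 0 ≤ mu := hlam.trans hle
  have hlaml : 0 ≤ lam * l := mul_nonneg hlam hl
  have hmul : 0 ≤ mu * l := mul_nonneg hmu hl
  have hlamle : lam * l ≤ mu * l := by gcongr
  have hadd : lam * l + mu * l = l := by linear_combination l * hsum
  obtain ⟨T, hT₁, hT₂⟩ := exists_choice_sum_mem_Icc (x := x)
    (a := fun i => p i ^ (n + 1)) (b := fun i => (p i + lam * l) ^ (n + 1))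
    (a' := fun i => (p i + mu * l) ^ (n + 1))
    (b' := fun i => (p i + mu * l + lam * l) ^ (n + 1)) hlo
    (hhi.trans_eq <| Finset.sum_congr rfl fun i _ => by rw [add_assoc, add_comm (mu * l), hadd])
    (by
      intro T j _
      have h₁ : (p j + mu * l) ^ (n + 1) - (p j + lam * l) ^ (n + 1) ≤
          (n + 1) * ((p j + mu * l) - (p j + lam * l)) :=
        pow_sub_pow_le_mul_sub (by linarith [hp j]) (by linarith) (by linarith [hp' j]) n
      have h₂ : ∀ i ∈ Finset.univ.erase j, (n + 1) * mu ^ n * (lam * l) ≤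
          (if i ∈ T then (p i + mu * l + lam * l) ^ (n + 1) else (p i + lam * l) ^ (n + 1)) -
          (if i ∈ T then (p i + mu * l) ^ (n + 1) else p i ^ (n + 1)) := by
        intro i _
        split_ifs
        · have := mul_sub_le_pow_sub_pow (a := p i + mu * l) (b := p i + mu * l + lam * l) hmu
            (by linarith [hp i]) (by linarith) n
          rwa [add_sub_cancel_left] at this
        · have := mul_sub_le_pow_sub_pow (a := p i) (b := p i + lam * l) hmu
            (hp i) (by linarith) n
          rwa [add_sub_cancel_left] at this
      have h₃ := Finset.card_nsmul_le_sum _ _ _ h₂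
      have hr1 : 1 ≤ r := j.pos
      rw [Finset.card_erase_of_mem (Finset.mem_univ j), Finset.card_univ, Fintype.card_fin,
        nsmul_eq_mul, Nat.cast_sub hr1, Nat.cast_one] at h₃
      refine h₁.trans (le_trans ?_ h₃)
      have h₄ := mul_le_mul_of_nonneg_left hr (by positivity : 0 ≤ ((n : ℝ) + 1) * l)
      linear_combination h₄)
  refine ⟨fun i => if i ∈ T then 1 else 0, fun i => by by_cases h : i ∈ T <;> simp [h],
    hT₁.trans_eq' ?_, hT₂.trans_eq ?_⟩ <;>
  · refine Finset.sum_congr rfl fun i _ => ?_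
    by_cases h : i ∈ T <;> simp [h]

theorem exists_digits_sum_pow_eq {lam mu x : ℝ} {n r : ℕ} (hlam : 0 ≤ lam) (hlam1 : lam < 1)
    (hle : lam ≤ mu) (hsum : lam + mu = 1) (hr : mu - lam ≤ (r - 1) * (mu ^ n * lam))
    (hlo : r * mu ^ (n + 1) ≤ x) (hhi : x ≤ r) :
    ∃ ε : Fin r → ℕ → ℝ, (∀ i k, ε i k = 0 ∨ ε i k = 1) ∧
      x = ∑ i, (∑' k, ε i k * mu * lam ^ k) ^ (n + 1) := by
  have hmu : 0 ≤ mu := hlam.trans hle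
  let Inv : ℕ → (Fin r → ℝ) → Prop := fun k p =>
    (∀ i, mu ≤ p i) ∧ (∀ i, p i + lam ^ (k + 1) ≤ 1) ∧
      ∑ i, p i ^ (n + 1) ≤ x ∧ x ≤ ∑ i, (p i + lam ^ (k + 1)) ^ (n + 1)
  have step : ∀ k, ∀ p : {p // Inv k p}, ∃ q : {q // Inv (k + 1) q}, ∃ e : Fin r → ℝ,
      (∀ i, e i = 0 ∨ e i = 1) ∧ ∀ i, q.1 i = p.1 i + e i * mu * lam ^ (k + 1) := by
    rintro k ⟨p, hp, hp', hplo, hphi⟩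
    have hl : 0 ≤ lam ^ (k + 1) := by positivity
    obtain ⟨e, he, h₁, h₂⟩ := exists_subdivision hlam hle hsum hr hl hp hp' hplo hphi
    have hadd : lam * lam ^ (k + 1) + mu * lam ^ (k + 1) = lam ^ (k + 1) := by
      linear_combination lam ^ (k + 1) * hsum
    have hmul : 0 ≤ mu * lam ^ (k + 1) := by positivity
    refine ⟨⟨fun i => p i + e i * mu * lam ^ (k + 1), fun i => ?_, fun i => ?_, h₁, ?_⟩,
      e, he, fun i => rfl⟩
    · rcases he i with h | h <;> simp only [h] <;> linarith [hp i]
    · rw [pow_succ' lam (k + 1)]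
      rcases he i with h | h <;> simp only [h] <;> linarith [hp' i]
    · rwa [pow_succ' lam (k + 1)]
  choose next e he hnext using step
  have hInv0 : Inv 0 fun _ => mu := by
    refine ⟨fun _ => le_rfl, fun _ => ?_, ?_, ?_⟩
    · rw [zero_add, pow_one, add_comm, hsum]
    · simpa using hlo
    · simpa [add_comm mu, hsum] using hhi
  let q : ∀ k, {p // Inv k p} := fun k => Nat.rec ⟨fun _ => mu, hInv0⟩ (fun k p => next k p) k
  let ε : Fin r → ℕ → ℝ := fun i k => Nat.casesOn k 1 fun k => e k (q k) i
  have hε : ∀ i k, ε i k = 0 ∨ ε i k = 1 := by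
    intro i k
    cases k with
    | zero => exact Or.inr rfl
    | succ k => exact he k (q k) i
  have hq : ∀ i k, (q k).1 i = ∑ j ∈ Finset.range (k + 1), ε i j * mu * lam ^ j := by
    intro i k
    induction k with
    | zero => simp [q, ε]
    | succ k ih =>
      rw [Finset.sum_range_succ, ← ih]
      exact hnext k (q k) i
  have hsummable : ∀ i, Summable fun k => ε i k * mu * lam ^ k := by
    intro i
    refine Summable.of_nonneg_of_le (fun k => ?_) (fun k => ?_)
      ((summable_geometric_of_lt_one hlam hlam1).mul_left mu)
    · rcases hε i k with h | h <;> rw [h] <;> positivity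
    · have : 0 ≤ mu * lam ^ k := by positivity
      rcases hε i k with h | h <;> rw [h] <;> linarith
  have hlim : ∀ i, Filter.Tendsto (fun k => (q k).1 i) Filter.atTop
      (nhds (∑' k, ε i k * mu * lam ^ k)) := by
    intro i
    simp only [hq]
    exact (Filter.tendsto_add_atTop_iff_nat 1).2 (hsummable i).hasSum.tendsto_sum_nat
  have hpow : Filter.Tendsto (fun k => lam ^ (k + 1)) Filter.atTop (nhds 0) :=
    (Filter.tendsto_add_atTop_iff_nat 1).2 (tendsto_pow_atTop_nhds_zero_of_lt_one hlam hlam1)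
  refine ⟨ε, hε, le_antisymm ?_ ?_⟩
  · have hsup : Filter.Tendsto (fun k => ∑ i, ((q k).1 i + lam ^ (k + 1)) ^ (n + 1)) Filter.atTop
        (nhds (∑ i, (∑' k, ε i k * mu * lam ^ k) ^ (n + 1))) :=
      tendsto_finsetSum _ fun i _ => by simpa using ((hlim i).add hpow).pow (n + 1)
    exact ge_of_tendsto' hsup fun k => (q k).2.2.2.2
  · exact le_of_tendsto' (tendsto_finsetSum _ fun i _ => (hlim i).pow (n + 1))
      fun k => (q k).2.2.2.1

theorem one_le_sCount_mul {α : ℝ} (hα : 0 < 1 + α) (n : ℕ) :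
    1 ≤ (sCount α (n + 1) : ℝ) * ((1 + α) / 2) ^ n := by
  have h : (2 / (1 + α)) ^ n ≤ (sCount α (n + 1) : ℝ) := Nat.le_ceil _
  calc (1 : ℝ) = (2 / (1 + α)) ^ n * ((1 + α) / 2) ^ n := by
        rw [← mul_pow, div_mul_div_cancel₀ hα.ne', div_self two_ne_zero, one_pow]
    _ ≤ _ := by gcongr

theorem le_kCount_mul {α : ℝ} (hα : α ∈ Set.Ioo (0 : ℝ) 1) (n : ℕ) :
    (3 * α - 1) / 2 ≤ (kCount α (n + 1) : ℝ) * (((1 + α) / 2) ^ n * ((1 - α) / 2)) := by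
  obtain ⟨h0, h1⟩ := hα
  have hlam : 0 < (1 - α) / 2 := by linarith
  by_cases h : 1 / 3 < α
  · have hY : 0 < ((1 + α) / 2) ^ n * ((1 - α ^ 2) / 4) := by
      have : 0 < 1 - α ^ 2 := by nlinarith
      positivity
    have hk : ((3 * α - 1) / 2) / (((1 + α) / 2) ^ n * ((1 - α ^ 2) / 4)) ≤
        (kCount α (n + 1) : ℝ) := by
      rw [kCount, if_pos h]
      exact Nat.le_ceil _
    rw [div_le_iff₀ hY] at hk
    refine hk.trans ?_
    gcongr ?_ * (_ * ?_)
    nlinarith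
  · have : 0 ≤ (kCount α (n + 1) : ℝ) * (((1 + α) / 2) ^ n * ((1 - α) / 2)) := by positivity
    linarith [not_lt.1 h]

/-- Lemma 2: the interval `I` is contained in `Γ_{α,m}`. -/
theorem interval_subset_Gamma (α : ℝ) (hα : α ∈ Set.Ioo (0 : ℝ) 1) (m : ℕ) (hm : 0 < m) :
    Set.Icc
      (((rCount α m : ℝ) / 2 - 1) + ((rCount α m : ℝ) / 2 + 1) * ((1 + α) / 2) ^ m)
      (((rCount α m : ℝ) / 2 + 1) + ((rCount α m : ℝ) / 2 - 1) * ((1 + α) / 2) ^ m)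
      ⊆ Gam α m := by
  obtain ⟨n, rfl⟩ := Nat.exists_eq_add_one.2 hm
  have hs := one_le_sCount_mul (by linarith [hα.1] : 0 < 1 + α) n
  have hk := le_kCount_mul hα n
  obtain ⟨h0, h1⟩ := hα
  rintro x ⟨hx₁, hx₂⟩
  have hr : (rCount α (n + 1) : ℝ) = 2 * sCount α (n + 1) + 2 * kCount α (n + 1) := by
    simp [rCount]
  have hs1 : (1 : ℝ) ≤ sCount α (n + 1) := by
    rw [Nat.one_le_cast, Nat.one_le_iff_ne_zero]
    intro h
    norm_num [h] at hs
  have hk0 : (0 : ℝ) ≤ kCount α (n + 1) := Nat.cast_nonneg _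
  have hlam : 0 < (1 - α) / 2 := by linarith
  have hpow : ((1 + α) / 2) ^ (n + 1) ≤ 1 := pow_le_one₀ (by linarith) (by linarith)
  have hhalf : 0 ≤ ((rCount α (n + 1) : ℝ) / 2 - 1) * (1 - ((1 + α) / 2) ^ (n + 1)) :=
    mul_nonneg (by linarith) (by linarith)
  have hX : 0 ≤ ((1 + α) / 2) ^ n * ((1 - α) / 2) := by positivity
  obtain ⟨ε, hε, hx⟩ := exists_digits_sum_pow_eq (lam := (1 - α) / 2) (mu := (1 + α) / 2) (x := x)
    (n := n) (r := rCount α (n + 1)) hlam.le (by linarith) (by linarith) (by ring)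
    (by
      have h₁ := mul_le_mul_of_nonneg_right hs hlam.le
      have h₂ : ((sCount α (n + 1) : ℝ) + kCount α (n + 1)) *
          (((1 + α) / 2) ^ n * ((1 - α) / 2)) ≤
          ((rCount α (n + 1) : ℝ) - 1) * (((1 + α) / 2) ^ n * ((1 - α) / 2)) :=
        mul_le_mul_of_nonneg_right (by linarith) hX
      linear_combination h₁ + h₂ + hk)
    (by linarith) (by linarith)
  exact ⟨fun i => ∑' k, ε i k * ((1 + α) / 2) * ((1 - α) / 2) ^ k,
    fun i => ⟨ε i, hε i, rfl⟩, hx⟩
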